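/- Let G be an undirected graph admitting a nowhere-zero circular k-flow (k ≥ 2 rational). Then every nowhere-zero τ-SCD w of the bidirected graph G⃗ can pack ⌊τ/(k+1)⌋ strongly connected spanning subdigraphs: there exist strongly connected spanning subdigraphs F₁,…,F_{⌊τ/(k+1)⌋} such that each arc e lies in at most w_e of them. -/

import Mathlib

open Finset

variable {V E : Type*} [Fintype V] [DecidableEq V] [Fintype E] [DecidableEq E]

/-- The arcs leaving the vertex set `U` (generic in the arc type). -/
def outArcs {A : Type*} [Fintype A] (src tgt : A → V) (U : Finset V) : Finset A :=
  univ.filter fun a => src a ∈ U ∧ tgt a ∉ U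

/-- Source of an arc of the bidirected graph `E × Bool`: `(e, true) = e⁺` goes from `s e` to
`t e`, and `(e, false) = e⁻` goes from `t e` to `s e`. -/
def bsrc (s t : E → V) (p : E × Bool) : V := if p.2 then s p.1 else t p.1

/-- Target of an arc of the bidirected graph `E × Bool`. -/
def btgt (s t : E → V) (p : E × Bool) : V := if p.2 then t p.1 else s p.1

/-- A strongly connected orientation of the graph with edges `E` and endpoints `s`, `t`:
a choice `O` of one direction per edge such that every nonempty proper cut has a leaving arc. -/
def IsSCO (s t : E → V) (O : E → Bool) : Prop :=
  ∀ U : Finset V, U.Nonempty → U ≠ univ →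
    ∃ e : E, (e, O e) ∈ outArcs (bsrc s t) (btgt s t) U

/-- Tail of an edge under the orientation `o`. -/
def otail (s t : E → V) (o : E → Bool) (e : E) : V := if o e then s e else t e

/-- Head of an edge under the orientation `o`. -/
def ohead (s t : E → V) (o : E → Bool) (e : E) : V := if o e then t e else s e

/-- The graph admits a nowhere-zero circular `k`-flow: an orientation together with a
circulation taking values in `[1, k-1]`. -/
def HasNZCircularFlow (s t : E → V) (k : ℚ) : Prop :=
  ∃ (o : E → Bool) (f : E → ℚ),
    (∀ v : V, ∑ e ∈ univ.filter (fun e => otail s t o e = v), f e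
            = ∑ e ∈ univ.filter (fun e => ohead s t o e = v), f e) ∧
    ∀ e : E, 1 ≤ f e ∧ f e ≤ k - 1

set_option linter.unusedSectionVars false

section Edmonds

variable {A : Type*} [Fintype A] [DecidableEq A]

lemma mem_outArcs {src tgt : A → V} {U : Finset V} {a : A} :
    a ∈ outArcs src tgt U ↔ src a ∈ U ∧ tgt a ∉ U := by
  simp [outArcs]

/-- The weighted cut function of a digraph with nonnegative weights is submodular. -/
lemma sum_outArcs_inter_add_union_le (src tgt : A → V) {h : A → ℤ} (hh : ∀ a, 0 ≤ h a)
    (U W : Finset V) :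
    ∑ a ∈ outArcs src tgt (U ∩ W), h a + ∑ a ∈ outArcs src tgt (U ∪ W), h a
      ≤ ∑ a ∈ outArcs src tgt U, h a + ∑ a ∈ outArcs src tgt W, h a := by
  simp only [outArcs, sum_filter, ← sum_add_distrib]
  refine sum_le_sum fun a _ => ?_
  have := hh a
  simp only [mem_inter, mem_union]
  by_cases h1 : src a ∈ U <;> by_cases h2 : src a ∈ W <;> by_cases h3 : tgt a ∈ U <;>
    by_cases h4 : tgt a ∈ W <;> simp [h1, h2, h3, h4, this]

/-- The arc used to extend a partial arborescence on the vertex set `S`: removing it from the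
weights `h` keeps every cut around the root `r` of weight at least `p`. -/
lemma exists_safe_arc (src tgt : A → V) (r : V) (p : ℤ) (hp : 0 ≤ p) {h : A → ℤ}
    (hh : ∀ a, 0 ≤ h a)
    (hcut : ∀ U : Finset V, r ∈ U → U ≠ univ → p ≤ ∑ a ∈ outArcs src tgt U, h a)
    {S : Finset V} (hS : S ≠ univ)
    (hcutS : ∀ U : Finset V, S ⊆ U → U ≠ univ → p + 1 ≤ ∑ a ∈ outArcs src tgt U, h a) :
    ∃ a, src a ∈ S ∧ tgt a ∉ S ∧ 1 ≤ h a ∧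
      ∀ W : Finset V, r ∈ W → a ∈ outArcs src tgt W → p + 1 ≤ ∑ a ∈ outArcs src tgt W, h a := by
  classical
  let T : Finset (Finset V) := univ.filter fun U =>
    r ∈ U ∧ U ∪ S ≠ univ ∧ ∑ a ∈ outArcs src tgt U, h a = p
  have hT : ∀ U, U ∈ T ↔ r ∈ U ∧ U ∪ S ≠ univ ∧ ∑ a ∈ outArcs src tgt U, h a = p := by
    simp [T]
  have ne_univ : ∀ {U : Finset V} {v : V}, v ∉ U → U ≠ univ := fun hv hU => hv (hU ▸ mem_univ _)
  have tight : ∀ W : Finset V, ∀ a, tgt a ∉ S → r ∈ W → a ∈ outArcs src tgt W →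
      ¬ p + 1 ≤ ∑ a ∈ outArcs src tgt W, h a → W ∈ T := by
    intro W a haS hrW haW hlt
    rw [mem_outArcs] at haW
    have := hcut W hrW (ne_univ haW.2)
    exact (hT W).2 ⟨hrW, ne_univ (v := tgt a) (by simp [haS, haW.2]), by omega⟩
  rcases T.eq_empty_or_nonempty with hE | hne
  · have hpos : ∑ a ∈ outArcs src tgt S, (0 : ℤ) < ∑ a ∈ outArcs src tgt S, h a := by
      have := hcutS S subset_rfl hS
      simp only [sum_const_zero]
      omega
    obtain ⟨a, ha, hpa⟩ := exists_lt_of_sum_lt hpos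
    rw [mem_outArcs] at ha
    refine ⟨a, ha.1, ha.2, by omega, fun W hrW haW => ?_⟩
    by_contra hlt
    simpa [hE] using tight W a ha.2 hrW haW hlt
  · obtain ⟨U, hU⟩ := T.exists_maximal hne
    obtain ⟨hrU, hUS, hUp⟩ := (hT U).1 hU.prop
    have hlt : ∑ a ∈ outArcs src tgt U, h a < ∑ a ∈ outArcs src tgt (U ∪ S), h a := by
      have := hcutS (U ∪ S) subset_union_right hUS
      omega
    obtain ⟨a, ha, haU, hpa⟩ : ∃ a ∈ outArcs src tgt (U ∪ S),
        a ∉ outArcs src tgt U ∧ 0 < h a := by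
      by_contra! hcon
      refine hlt.not_ge ?_
      rw [← sum_filter_add_sum_filter_not (outArcs src tgt (U ∪ S)) (· ∈ outArcs src tgt U)]
      have h1 : ∑ a ∈ (outArcs src tgt (U ∪ S)).filter (· ∉ outArcs src tgt U), h a ≤ 0 :=
        sum_nonpos fun a ha => hcon a (mem_filter.1 ha).1 (mem_filter.1 ha).2
      have h2 : ∑ a ∈ (outArcs src tgt (U ∪ S)).filter (· ∈ outArcs src tgt U), h a
          ≤ ∑ a ∈ outArcs src tgt U, h a :=
        sum_le_sum_of_subset_of_nonneg (fun a ha => (mem_filter.1 ha).2) fun a _ _ => hh a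
      omega
    simp only [mem_outArcs, mem_union, not_or] at ha haU
    obtain ⟨hsrc, htU, htS⟩ := ha
    have hsU : src a ∉ U := fun hs => haU ⟨hs, htU⟩
    refine ⟨a, hsrc.resolve_left hsU, htS, by omega, fun W hrW haW => ?_⟩
    by_contra hW
    obtain ⟨-, -, hWp⟩ := (hT W).1 (tight W a htS hrW haW hW)
    rw [mem_outArcs] at haW
    have hsub := sum_outArcs_inter_add_union_le src tgt hh U W
    have hI := hcut (U ∩ W) (by simp [hrU, hrW]) (ne_univ (v := tgt a) (by simp [htU]))
    have hJ := hcut (U ∪ W) (by simp [hrU]) (ne_univ (v := tgt a) (by simp [htU, haW.2]))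
    have hUW : U ∪ W ∈ T :=
      (hT _).2 ⟨by simp [hrU], ne_univ (v := tgt a) (by simp [htU, htS, haW.2]), by omega⟩
    exact hsU (hU.le_of_ge hUW subset_union_left (mem_union_right _ haW.1))

/-- If every cut around `r` has weight at least `p + 1`, some arc set within the weights reaches
every vertex from `r` and leaves weight at least `p` on each of these cuts. -/
lemma exists_spanning_arcs_of_cut (src tgt : A → V) (r : V) (p : ℤ) (hp : 0 ≤ p) {x : A → ℤ}
    (hx : ∀ a, 0 ≤ x a)
    (hcut : ∀ U : Finset V, r ∈ U → U ≠ univ → p + 1 ≤ ∑ a ∈ outArcs src tgt U, x a) :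
    ∃ F : Finset A, (∀ U : Finset V, r ∈ U → U ≠ univ → (outArcs src tgt U ∩ F).Nonempty) ∧
      (∀ a, 0 ≤ x a - if a ∈ F then 1 else 0) ∧
      ∀ U : Finset V, r ∈ U → U ≠ univ →
        p ≤ ∑ a ∈ outArcs src tgt U, (x a - if a ∈ F then 1 else 0) := by
  have grow : ∀ n < Fintype.card V, ∃ (S : Finset V) (F : Finset A), S.card = n + 1 ∧ r ∈ S ∧
      (∀ a ∈ F, tgt a ∈ S) ∧
      (∀ U : Finset V, r ∈ U → ¬ S ⊆ U → (outArcs src tgt U ∩ F).Nonempty) ∧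
      (∀ a, 0 ≤ x a - if a ∈ F then 1 else 0) ∧
      ∀ U : Finset V, r ∈ U → U ≠ univ →
        p ≤ ∑ a ∈ outArcs src tgt U, (x a - if a ∈ F then 1 else 0) := by
    intro n
    induction n with
    | zero =>
      intro _
      refine ⟨{r}, ∅, by simp, by simp, by simp, fun U hU hn => ?_, by simpa using hx,
        fun U hU hn => ?_⟩
      · simp [hU] at hn
      · have := hcut U hU hn
        simp only [notMem_empty, if_false, sub_zero]
        omega
    | succ n ih =>
      intro hn
      obtain ⟨S, F, hcard, hr, hF, hcov, hh, hFcut⟩ := ih (by omega)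
      have hS : S ≠ univ := by
        rintro rfl
        rw [card_univ] at hcard
        omega
      obtain ⟨a, has, hat, ha1, hsafe⟩ := exists_safe_arc src tgt r p hp hh hFcut hS (by
        intro U hSU hU
        refine (hcut U (hSU hr) hU).trans_eq (sum_congr rfl fun a ha => ?_)
        have : a ∉ F := fun haF => (mem_outArcs.1 ha).2 (hSU (hF a haF))
        simp [this])
      have haF : a ∉ F := fun h => hat (hF a h)
      have hins : ∀ b, (x b - if b ∈ insert a F then (1 : ℤ) else 0)
          = (x b - if b ∈ F then 1 else 0) - if b = a then 1 else 0 := by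
        intro b
        by_cases hb : b = a
        · subst hb; simp [haF]
        · simp [hb]
      refine ⟨insert (tgt a) S, insert a F, by rw [card_insert_of_notMem hat, hcard],
        mem_insert_of_mem hr, ?_, ?_, ?_, ?_⟩
      · intro b hb
        rcases mem_insert.1 hb with rfl | hb
        · exact mem_insert_self _ _
        · exact mem_insert_of_mem (hF b hb)
      · intro U hrU hSU
        by_cases hsub : S ⊆ U
        · have : tgt a ∉ U := fun h => hSU (insert_subset h hsub)
          exact ⟨a, mem_inter.2 ⟨mem_outArcs.2 ⟨hsub has, this⟩, mem_insert_self _ _⟩⟩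
        · exact (hcov U hrU hsub).mono (inter_subset_inter_left (subset_insert _ _))
      · intro b
        rw [hins]
        have := hh b
        by_cases hb : b = a
        · subst hb; simp only [if_true]; omega
        · simpa [hb] using this
      · intro U hrU hU
        simp only [hins]
        rw [sum_sub_distrib, sum_ite_eq']
        by_cases haU : a ∈ outArcs src tgt U
        · have := hsafe U hrU haU
          rw [if_pos haU]; omega
        · have := hFcut U hrU hU
          rw [if_neg haU]; omega
  have hV : 0 < Fintype.card V := Fintype.card_pos_iff.2 ⟨r⟩
  obtain ⟨S, F, hcard, -, -, hcov, hh, hFcut⟩ := grow (Fintype.card V - 1) (by omega)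
  obtain rfl : S = univ := eq_univ_of_card S (by omega)
  exact ⟨F, fun U hrU hU => hcov U hrU fun h => hU (univ_subset_iff.1 h), hh, hFcut⟩

/-- Edmonds' disjoint arborescences theorem, weighted form: if every cut around `r` has weight at
least `p`, the weights pack `p` arc sets each meeting all cuts around `r`. -/
theorem edmonds_packing (src tgt : A → V) (r : V) (p : ℕ) {x : A → ℤ} (hx : ∀ a, 0 ≤ x a)
    (hcut : ∀ U : Finset V, r ∈ U → U ≠ univ → (p : ℤ) ≤ ∑ a ∈ outArcs src tgt U, x a) :
    ∃ F : Fin p → Finset A,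
      (∀ i, ∀ U : Finset V, r ∈ U → U ≠ univ → (outArcs src tgt U ∩ F i).Nonempty) ∧
      ∀ a, ((univ.filter fun i => a ∈ F i).card : ℤ) ≤ x a := by
  induction p generalizing x with
  | zero => exact ⟨fun _ => ∅, fun i => i.elim0, by simpa using hx⟩
  | succ p ih =>
    obtain ⟨F₀, hF₀, hh, hcut'⟩ :=
      exists_spanning_arcs_of_cut src tgt r p (by positivity) hx (by exact_mod_cast hcut)
    obtain ⟨F, hF, hcard⟩ := ih hh hcut'
    refine ⟨Fin.cons F₀ F, fun i => ?_, fun a => ?_⟩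
    · refine Fin.cases ?_ (fun j => ?_) i
      · simpa using hF₀
      · simpa using hF j
    · have := hcard a
      rw [Fin.card_filter_univ_succ]
      simp only [Fin.cons_zero, Fin.cons_succ]
      split_ifs at this ⊢ <;> push_cast <;> omega

/-- If two weight functions have all cuts of weight at least `p`, their sum packs `p` strongly
connected spanning subdigraphs. -/
lemma exists_strong_packing_add (src tgt : A → V) (p : ℕ) {x y : A → ℤ} (hx : ∀ a, 0 ≤ x a)
    (hy : ∀ a, 0 ≤ y a)
    (hxcut : ∀ U : Finset V, U.Nonempty → U ≠ univ → (p : ℤ) ≤ ∑ a ∈ outArcs src tgt U, x a)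
    (hycut : ∀ U : Finset V, U.Nonempty → U ≠ univ → (p : ℤ) ≤ ∑ a ∈ outArcs src tgt U, y a) :
    ∃ F : Fin p → Finset A,
      (∀ i, ∀ U : Finset V, U.Nonempty → U ≠ univ → (outArcs src tgt U ∩ F i).Nonempty) ∧
      ∀ a, ((univ.filter fun i => a ∈ F i).card : ℤ) ≤ x a + y a := by
  rcases isEmpty_or_nonempty V with hV | ⟨⟨r⟩⟩
  · exact ⟨fun _ => ∅, fun i U hU => (hV.elim hU.choose), fun a => by
      simpa using add_nonneg (hx a) (hy a)⟩
  have hrev : ∀ U : Finset V, outArcs tgt src U = outArcs src tgt Uᶜ := by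
    intro U
    ext a
    simp [mem_outArcs, and_comm]
  obtain ⟨F₁, hF₁, hc₁⟩ := edmonds_packing src tgt r p hx fun U hr hU => hxcut U ⟨r, hr⟩ hU
  obtain ⟨F₂, hF₂, hc₂⟩ := edmonds_packing tgt src r p hy fun U hr hU => by
    rw [hrev]
    refine hycut _ ?_ ?_
    · rwa [nonempty_iff_ne_empty, Ne, compl_eq_empty_iff]
    · rw [Ne, compl_eq_univ_iff]
      exact ne_empty_of_mem hr
  refine ⟨fun i => F₁ i ∪ F₂ i, fun i U hne hU => ?_, fun a => ?_⟩
  · by_cases hr : r ∈ U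
    · exact (hF₁ i U hr hU).mono (inter_subset_inter_left subset_union_left)
    · have := hF₂ i Uᶜ (mem_compl.2 hr) (by rw [Ne, compl_eq_univ_iff]; exact hne.ne_empty)
      rw [hrev, compl_compl] at this
      exact this.mono (inter_subset_inter_left subset_union_right)
  · have h1 := hc₁ a
    have h2 := hc₂ a
    have h3 : (univ.filter fun i => a ∈ F₁ i ∪ F₂ i).card ≤
        (univ.filter fun i => a ∈ F₁ i).card + (univ.filter fun i => a ∈ F₂ i).card := by
      simp only [mem_union, filter_or]
      exact card_union_le _ _
    dsimp only
    omega

end Edmonds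

/-- A circulation has equal total flow out of and into every vertex set. -/
lemma sum_outArcs_eq_of_conservation {a b : E → V} {f : E → ℚ}
    (hf : ∀ v : V, ∑ e ∈ univ.filter (fun e => a e = v), f e
      = ∑ e ∈ univ.filter (fun e => b e = v), f e) (U : Finset V) :
    ∑ e ∈ outArcs a b U, f e = ∑ e ∈ outArcs b a U, f e := by
  have h := sum_congr (rfl : U = U) fun v _ => hf v
  simp only [sum_filter] at h
  rw [sum_comm, sum_comm (s := U)] at h
  simp only [sum_ite_eq] at h
  have h' : ∑ e, ((if a e ∈ U ∧ b e ∉ U then f e else 0) - if b e ∈ U ∧ a e ∉ U then f e else 0)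
      = ∑ e, ((if a e ∈ U then f e else 0) - if b e ∈ U then f e else 0) := by
    refine sum_congr rfl fun e _ => ?_
    by_cases h1 : a e ∈ U <;> by_cases h2 : b e ∈ U <;> simp [h1, h2]
  simp only [outArcs, sum_filter]
  rw [sum_sub_distrib, sum_sub_distrib] at h'
  linarith

/-- The cut of the bidirected graph splits along any orientation. -/
lemma sum_outArcs_bidirected (s t : E → V) (o : E → Bool) (g : E × Bool → ℚ) (U : Finset V) :
    ∑ p ∈ outArcs (bsrc s t) (btgt s t) U, g p
      = ∑ e ∈ outArcs (otail s t o) (ohead s t o) U, g (e, o e)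
        + ∑ e ∈ outArcs (ohead s t o) (otail s t o) U, g (e, !o e) := by
  simp only [outArcs, sum_filter]
  rw [Fintype.sum_prod_type, ← sum_add_distrib]
  refine sum_congr rfl fun e _ => ?_
  cases h : o e <;> simp [bsrc, btgt, otail, ohead, h, add_comm]

/-- Rounding half of `w` up along `o` and down against it keeps a `1 / (k + 1)` fraction of a cut
in which at most `k - 1` times as many edges go against `o` as along it. -/
lemma div_le_sum_half (s t : E → V) (o : E → Bool) {k : ℚ} (hk : 2 ≤ k) {w : E × Bool → ℤ}
    (hw : ∀ p, 1 ≤ w p) {U : Finset V}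
    (hU : ((outArcs (ohead s t o) (otail s t o) U).card : ℚ)
      ≤ (k - 1) * (outArcs (otail s t o) (ohead s t o) U).card) :
    (∑ p ∈ outArcs (bsrc s t) (btgt s t) U, (w p : ℚ)) / (k + 1)
      ≤ ∑ p ∈ outArcs (bsrc s t) (btgt s t) U,
        (((if p.2 = o p.1 then (w p + 1) / 2 else w p / 2 : ℤ)) : ℚ) := by
  have hk1 : 0 < k + 1 := by linarith
  have up : ∀ n : ℤ, 1 ≤ n → (n : ℚ) + (k - 1) ≤ (((n + 1) / 2 : ℤ) : ℚ) * (k + 1) := by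
    intro n hn
    have h1 : n ≤ 2 * ((n + 1) / 2) := by omega
    have h2 : 1 ≤ (n + 1) / 2 := by omega
    have h1' : (n : ℚ) ≤ 2 * (((n + 1) / 2 : ℤ) : ℚ) := by exact_mod_cast h1
    have h2' : (1 : ℚ) ≤ (((n + 1) / 2 : ℤ) : ℚ) := by exact_mod_cast h2
    nlinarith
  have down : ∀ n : ℤ, 1 ≤ n → (n : ℚ) - 1 ≤ ((n / 2 : ℤ) : ℚ) * (k + 1) := by
    intro n hn
    have h1 : n - 1 ≤ 2 * (n / 2) := by omega
    have h2 : 0 ≤ n / 2 := by omega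
    have h1' : (n : ℚ) - 1 ≤ 2 * ((n / 2 : ℤ) : ℚ) := by exact_mod_cast h1
    have h2' : (0 : ℚ) ≤ ((n / 2 : ℤ) : ℚ) := by exact_mod_cast h2
    nlinarith
  rw [div_le_iff₀ hk1, sum_outArcs_bidirected s t o, sum_outArcs_bidirected s t o]
  have h1 := sum_le_sum fun e (_ : e ∈ outArcs (otail s t o) (ohead s t o) U) =>
    up (w (e, o e)) (hw _)
  have h2 := sum_le_sum fun e (_ : e ∈ outArcs (ohead s t o) (otail s t o) U) =>
    down (w (e, !o e)) (hw _)
  rw [sum_add_distrib, ← sum_mul, sum_const, nsmul_eq_mul] at h1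
  rw [sum_sub_distrib, ← sum_mul, sum_const, nsmul_eq_mul] at h2
  simp only [if_true, Bool.not_eq_eq_eq_not, Bool.eq_not_self, if_false]
  linarith

/-- In a circulation with values in `[1, c]`, each direction of a cut has at most `c` times as
many edges as the other. -/
lemma card_outArcs_le_of_circulation {a b : E → V} {f : E → ℚ} {c : ℚ}
    (hf : ∀ v : V, ∑ e ∈ univ.filter (fun e => a e = v), f e
      = ∑ e ∈ univ.filter (fun e => b e = v), f e)
    (hb : ∀ e, 1 ≤ f e ∧ f e ≤ c) (U : Finset V) :
    ((outArcs b a U).card : ℚ) ≤ c * (outArcs a b U).card := by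
  have h1 := card_nsmul_le_sum (outArcs b a U) f 1 fun e _ => (hb e).1
  have h2 := sum_le_card_nsmul (outArcs a b U) f c fun e _ => (hb e).2
  have h3 := sum_outArcs_eq_of_conservation hf U
  rw [nsmul_eq_mul, mul_one] at h1
  rw [nsmul_eq_mul] at h2
  linarith

/-- If `G` admits a nowhere-zero circular `k`-flow, every nowhere-zero `τ`-SCD `w` of the
bidirected graph packs `⌊τ/(k+1)⌋` strongly connected spanning subdigraphs: each arc `p`
lies in at most `w p` of them. -/
theorem pack_scd_from_nz_scd (s t : E → V) (k : ℚ) (hk : 2 ≤ k)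
    (hflow : HasNZCircularFlow s t k) (τ : ℕ) (w : E × Bool → ℤ)
    (hw1 : ∀ p : E × Bool, 1 ≤ w p)
    (hw2 : ∀ U : Finset V, U.Nonempty → U ≠ univ →
      (τ : ℤ) ≤ ∑ p ∈ outArcs (bsrc s t) (btgt s t) U, w p) :
    ∃ F : Fin (⌊(τ : ℚ) / (k + 1)⌋.toNat) → Finset (E × Bool),
      (∀ i, ∀ U : Finset V, U.Nonempty → U ≠ univ →
        (outArcs (bsrc s t) (btgt s t) U ∩ F i).Nonempty) ∧
      ∀ p : E × Bool, ((univ.filter fun i => p ∈ F i).card : ℤ) ≤ w p := by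
  obtain ⟨o, f, hf, hb⟩ := hflow
  set o' : E → Bool := fun e => !o e with ho'
  have htail : otail s t o' = ohead s t o := by
    ext e; cases h : o e <;> simp [otail, ohead, ho', h]
  have hhead : ohead s t o' = otail s t o := by
    ext e; cases h : o e <;> simp [otail, ohead, ho', h]
  have key : ∀ q : E → Bool, (∀ U : Finset V, ((outArcs (ohead s t q) (otail s t q) U).card : ℚ)
      ≤ (k - 1) * (outArcs (otail s t q) (ohead s t q) U).card) →
      ∀ U : Finset V, U.Nonempty → U ≠ univ → ((⌊(τ : ℚ) / (k + 1)⌋.toNat : ℕ) : ℤ)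
        ≤ ∑ p ∈ outArcs (bsrc s t) (btgt s t) U,
          if p.2 = q p.1 then (w p + 1) / 2 else w p / 2 := by
    intro q hq U hne hU
    rw [Int.toNat_of_nonneg (Int.floor_nonneg.2 (div_nonneg (by positivity) (by linarith)))]
    have h1 := div_le_sum_half s t q hk hw1 (hq U)
    have h2 : (τ : ℚ) ≤ ∑ p ∈ outArcs (bsrc s t) (btgt s t) U, (w p : ℚ) := by
      exact_mod_cast hw2 U hne hU
    have h3 := (div_le_div_of_nonneg_right h2 (by linarith : (0 : ℚ) ≤ k + 1)).trans h1
    have h4 := (Int.floor_le ((τ : ℚ) / (k + 1))).trans h3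
    exact_mod_cast h4
  have hnonneg : ∀ (q : E → Bool) (p : E × Bool),
      0 ≤ if p.2 = q p.1 then (w p + 1) / 2 else w p / 2 := by
    intro q p
    have := hw1 p
    split_ifs <;> omega
  obtain ⟨F, hF, hcard⟩ := exists_strong_packing_add (bsrc s t) (btgt s t) _
    (hnonneg o) (hnonneg o')
    (key o fun U => card_outArcs_le_of_circulation hf hb U)
    (key o' fun U => by
      rw [htail, hhead]
      exact card_outArcs_le_of_circulation (fun v => (hf v).symm) hb U)
  refine ⟨F, hF, fun p => (hcard p).trans_eq ?_⟩
  obtain ⟨e, c⟩ := p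
  cases c <;> cases h : o e <;> simp [ho', h] <;> omega
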